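/- arXiv:2306.07895 — 3 statements merged into one kernel-verified Lean document; each statement's English description precedes it below -/
import Mathlib

section
/- Let E and F be real normed vector spaces, let n be a natural number, and let f : E → F be of class C^n. Then for every q, v ∈ E and every k ≤ n, the k-th derivative at t = 0 of the one-variable function t ↦ f(q + t·v) equals the k-th iterated Fréchet derivative of f at q applied to the constant family (v, v, …, v): iteratedDeriv k (fun t => f (q + t • v)) 0 = (iteratedFDeriv ℝ k f q)(v, …, v). -/
/-- For `f : E → F` of class `C^n` and `k ≤ n`, the `k`-th derivative at `t = 0` of
`t ↦ f(q + t·v)` equals the `k`-th iterated Fréchet derivative of `f` at `q`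
applied to `(v, …, v)`. -/
theorem iteratedDeriv_along_direction {E F : Type*}
    [NormedAddCommGroup E] [NormedSpace ℝ E]
    [NormedAddCommGroup F] [NormedSpace ℝ F]
    (n : ℕ) (f : E → F) (hf : ContDiff ℝ n f) (q v : E) (k : ℕ) (hk : k ≤ n) :
    iteratedDeriv k (fun t : ℝ => f (q + t • v)) 0 =
      iteratedFDeriv ℝ k f q (fun _ => v) := by
  have hshift : ContDiff ℝ n fun z : E => f (q + z) :=
    hf.comp (contDiff_const.add contDiff_id)
  let g : ℝ →L[ℝ] E := ContinuousLinearMap.toSpanSingleton ℝ v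
  have hcomp : (fun t : ℝ => f (q + t • v)) = (fun z : E => f (q + z)) ∘ g := by
    ext t
    simp [g]
  rw [iteratedDeriv_eq_iteratedFDeriv, hcomp,
    g.iteratedFDeriv_comp_right hshift 0 (by exact_mod_cast hk), iteratedFDeriv_comp_add_left]
  simp [g]
end

section
/- Let E and F be real normed vector spaces, let f : E → F be of class C³ and g : ℝ → E be three times differentiable. Define r : ℝ → F by r(t) = f(g(t)). Then for every t ∈ ℝ, the third derivative of r satisfies: r'''(t) = (iteratedFDeriv ℝ 3 f (g t))(g'(t), g'(t), g'(t)) + 3·(iteratedFDeriv ℝ 2 f (g t))(g''(t), g'(t)) + (Df(g t))(g'''(t)). -/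
/-- Leibniz and chain rule for a field of continuous linear maps evaluated along a curve. -/
theorem hasDerivAt_comp_clm_apply {E G F : Type*}
    [NormedAddCommGroup E] [NormedSpace ℝ E] [NormedAddCommGroup G] [NormedSpace ℝ G]
    [NormedAddCommGroup F] [NormedSpace ℝ F]
    {A : E → G →L[ℝ] F} {g : ℝ → E} {v : ℝ → G} {s : ℝ}
    (hA : DifferentiableAt ℝ A (g s)) (hg : DifferentiableAt ℝ g s)
    (hv : DifferentiableAt ℝ v s) :
    HasDerivAt (fun s => A (g s) (v s))
      (fderiv ℝ A (g s) (deriv g s) (v s) + A (g s) (deriv v s)) s :=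
  (hA.hasFDerivAt.comp_hasDerivAt s hg.hasDerivAt).clm_apply hv.hasDerivAt

theorem iteratedFDeriv_three_apply {E F : Type*}
    [NormedAddCommGroup E] [NormedSpace ℝ E] [NormedAddCommGroup F] [NormedSpace ℝ F]
    (f : E → F) (x : E) (m : Fin 3 → E) :
    iteratedFDeriv ℝ 3 f x m = fderiv ℝ (fderiv ℝ (fderiv ℝ f)) x (m 0) (m 1) (m 2) := by
  rw [iteratedFDeriv_succ_apply_right, iteratedFDeriv_two_apply]
  rfl

/-- Jerk formula: for `f : E → F` of class `C³` and `g : ℝ → E` three times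
differentiable, `r = f ∘ g` satisfies
`r'''(t) = d₃(g',g',g') + 3·d₂(g'',g') + d₁(g''')` at `g t`. -/
theorem third_deriv_chain_rule {E F : Type*}
    [NormedAddCommGroup E] [NormedSpace ℝ E]
    [NormedAddCommGroup F] [NormedSpace ℝ F]
    (f : E → F) (hf : ContDiff ℝ 3 f)
    (g : ℝ → E) (hg : Differentiable ℝ g) (hg' : Differentiable ℝ (deriv g))
    (hg'' : Differentiable ℝ (deriv (deriv g)))
    (t : ℝ) :
    iteratedDeriv 3 (fun s : ℝ => f (g s)) t =
      iteratedFDeriv ℝ 3 f (g t) ![deriv g t, deriv g t, deriv g t]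
        + (3 : ℝ) • iteratedFDeriv ℝ 2 f (g t) ![deriv (deriv g) t, deriv g t]
        + fderiv ℝ f (g t) (deriv (deriv (deriv g)) t) := by
  have hf₁ : ContDiff ℝ 2 (fderiv ℝ f) := hf.fderiv_right (by norm_num)
  have hf₂ : ContDiff ℝ 1 (fderiv ℝ (fderiv ℝ f)) := hf₁.fderiv_right (by norm_num)
  have df₁ : Differentiable ℝ (fderiv ℝ f) := hf₁.differentiable (by norm_num)
  have df₂ : Differentiable ℝ (fderiv ℝ (fderiv ℝ f)) := hf₂.differentiable (by norm_num)
  have first : deriv (fun s => f (g s)) = fun s => fderiv ℝ f (g s) (deriv g s) := by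
    funext s
    exact ((hf.differentiable (by norm_num) (g s)).hasFDerivAt.comp_hasDerivAt s
      (hg s).hasDerivAt).deriv
  have second : deriv (fun s => fderiv ℝ f (g s) (deriv g s)) = fun s =>
      fderiv ℝ (fderiv ℝ f) (g s) (deriv g s) (deriv g s)
        + fderiv ℝ f (g s) (deriv (deriv g) s) := by
    funext s
    exact (hasDerivAt_comp_clm_apply (df₁ _) (hg s) (hg' s)).deriv
  have third : deriv (fun s => fderiv ℝ (fderiv ℝ f) (g s) (deriv g s) (deriv g s)
        + fderiv ℝ f (g s) (deriv (deriv g) s)) t =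
      (fderiv ℝ (fderiv ℝ (fderiv ℝ f)) (g t) (deriv g t) (deriv g t)
          + fderiv ℝ (fderiv ℝ f) (g t) (deriv (deriv g) t)) (deriv g t)
        + fderiv ℝ (fderiv ℝ f) (g t) (deriv g t) (deriv (deriv g) t)
        + (fderiv ℝ (fderiv ℝ f) (g t) (deriv g t) (deriv (deriv g) t)
          + fderiv ℝ f (g t) (deriv (deriv (deriv g)) t)) :=
    (((hasDerivAt_comp_clm_apply (df₂ _) (hg t) (hg' t)).clm_apply (hg' t).hasDerivAt).fun_add
      (hasDerivAt_comp_clm_apply (df₁ _) (hg t) (hg'' t))).deriv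
  have symm : fderiv ℝ (fderiv ℝ f) (g t) (deriv g t) (deriv (deriv g) t)
      = fderiv ℝ (fderiv ℝ f) (g t) (deriv (deriv g) t) (deriv g t) :=
    (hf.contDiffAt.isSymmSndFDerivAt (by norm_num)).eq _ _
  rw [iteratedDeriv_succ', iteratedDeriv_succ', iteratedDeriv_one, first, second, third,
    iteratedFDeriv_three_apply, iteratedFDeriv_two_apply]
  simp only [add_apply, symm, Matrix.cons_val]
  module
end

section
/- Let E and F be real normed vector spaces, let f : E → F be of class C⁴ and g : ℝ → E be four times differentiable. Define r : ℝ → F by r(t) = f(g(t)). Then for every t ∈ ℝ, the fourth derivative of r satisfies: r''''(t) = (iteratedFDeriv ℝ 4 f (g t))(g'(t), g'(t), g'(t), g'(t)) + 6·(iteratedFDeriv ℝ 3 f (g t))(g''(t), g'(t), g'(t)) + 4·(iteratedFDeriv ℝ 2 f (g t))(g'''(t), g'(t)) + 3·(iteratedFDeriv ℝ 2 f (g t))(g''(t), g''(t)) + (Df(g t))(g''''(t)). -/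
section CurriedDerivatives

variable {E F : Type*} [NormedAddCommGroup E] [NormedSpace ℝ E]
  [NormedAddCommGroup F] [NormedSpace ℝ F]

/-- Product rule for a field of continuous linear maps evaluated along a curve. -/
theorem HasDerivAt.clm_apply_comp {L : E → E →L[ℝ] F} {g u : ℝ → E} {g' u' : E} {t : ℝ}
    (hL : DifferentiableAt ℝ L (g t)) (hg : HasDerivAt g g' t) (hu : HasDerivAt u u' t) :
    HasDerivAt (fun s => L (g s) (u s)) (fderiv ℝ L (g t) g' (u t) + L (g t) u') t :=
  (hL.hasFDerivAt.comp_hasDerivAt t hg).clm_apply hu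

/-- The second derivative of a `C²` map is symmetric. -/
theorem ContDiff.fderiv_fderiv_comm {f : E → F} (hf : ContDiff ℝ 2 f) (x a b : E) :
    fderiv ℝ (fderiv ℝ f) x a b = fderiv ℝ (fderiv ℝ f) x b a :=
  hf.contDiffAt.isSymmSndFDerivAt (by simp) a b

/-- The third derivative of a `C³` map is symmetric in its last two arguments. -/
theorem ContDiff.fderiv_fderiv_fderiv_comm_right {f : E → F} (hf : ContDiff ℝ 3 f)
    (x a b c : E) :
    fderiv ℝ (fderiv ℝ (fderiv ℝ f)) x a b c = fderiv ℝ (fderiv ℝ (fderiv ℝ f)) x a c b := by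
  have hD : Differentiable ℝ (fderiv ℝ (fderiv ℝ f)) :=
    ((hf.fderiv_right (m := 2) (by norm_num)).fderiv_right
      (m := 1) (by norm_num)).differentiable (by norm_num)
  have key (v w : E) : fderiv ℝ (fun y => fderiv ℝ (fderiv ℝ f) y v w) x a =
      fderiv ℝ (fderiv ℝ (fderiv ℝ f)) x a v w := by
    have h := ((hD x).hasFDerivAt.clm_apply (hasFDerivAt_const v x)).clm_apply
      (hasFDerivAt_const w x)
    rw [h.fderiv]
    simp
  rw [← key b c, ← key c b]
  simp_rw [(hf.of_le (by norm_num)).fderiv_fderiv_comm _ b c]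

end CurriedDerivatives

set_option maxSynthPendingDepth 3 in
/-- Jounce/snap formula: for `f : E → F` of class `C⁴` and `g : ℝ → E` four times
differentiable, `r = f ∘ g` satisfies
`r''''(t) = d₄(g',g',g',g') + 6·d₃(g'',g',g') + 4·d₂(g''',g') + 3·d₂(g'',g'') + d₁(g'''')`
at `g t`. -/
theorem fourth_deriv_chain_rule {E F : Type*}
    [NormedAddCommGroup E] [NormedSpace ℝ E]
    [NormedAddCommGroup F] [NormedSpace ℝ F]
    (f : E → F) (hf : ContDiff ℝ 4 f)
    (g : ℝ → E) (hg : Differentiable ℝ g) (hg' : Differentiable ℝ (deriv g))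
    (hg'' : Differentiable ℝ (deriv (deriv g)))
    (hg''' : Differentiable ℝ (deriv (deriv (deriv g))))
    (t : ℝ) :
    iteratedDeriv 4 (fun s : ℝ => f (g s)) t =
      iteratedFDeriv ℝ 4 f (g t) ![deriv g t, deriv g t, deriv g t, deriv g t]
        + (6 : ℝ) • iteratedFDeriv ℝ 3 f (g t)
            ![deriv (deriv g) t, deriv g t, deriv g t]
        + (4 : ℝ) • iteratedFDeriv ℝ 2 f (g t)
            ![deriv (deriv (deriv g)) t, deriv g t]
        + (3 : ℝ) • iteratedFDeriv ℝ 2 f (g t)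
            ![deriv (deriv g) t, deriv (deriv g) t]
        + fderiv ℝ f (g t) (deriv (deriv (deriv (deriv g))) t) := by
  have hD1 : ContDiff ℝ 3 (fderiv ℝ f) := hf.fderiv_right (by norm_num)
  have hD2 : ContDiff ℝ 2 (fderiv ℝ (fderiv ℝ f)) := hD1.fderiv_right (by norm_num)
  have hD3 : ContDiff ℝ 1 (fderiv ℝ (fderiv ℝ (fderiv ℝ f))) := hD2.fderiv_right (by norm_num)
  have d0 : Differentiable ℝ f := hf.differentiable (by norm_num)
  have d1 := hD1.differentiable (by norm_num)
  have d2 := hD2.differentiable (by norm_num)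
  have d3 := hD3.differentiable (by norm_num)
  have symm2 := (hf.of_le (by norm_num : (2 : WithTop ℕ∞) ≤ 4)).fderiv_fderiv_comm
  have symm3 := (hD1.of_le (by norm_num : (2 : WithTop ℕ∞) ≤ 3)).fderiv_fderiv_comm
  have symm3' :=
    (hf.of_le (by norm_num : (3 : WithTop ℕ∞) ≤ 4)).fderiv_fderiv_fderiv_comm_right
  have e1 : deriv (fun s => f (g s)) = fun s => fderiv ℝ f (g s) (deriv g s) := by
    funext s
    exact ((d0 (g s)).hasFDerivAt.comp_hasDerivAt s (hg s).hasDerivAt).deriv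
  have e2 : deriv (fun s => fderiv ℝ f (g s) (deriv g s)) = fun s =>
      fderiv ℝ (fderiv ℝ f) (g s) (deriv g s) (deriv g s)
        + fderiv ℝ f (g s) (deriv (deriv g) s) := by
    funext s
    exact (HasDerivAt.clm_apply_comp (d1 _) (hg s).hasDerivAt (hg' s).hasDerivAt).deriv
  have e3 : deriv (fun s => fderiv ℝ (fderiv ℝ f) (g s) (deriv g s) (deriv g s)
        + fderiv ℝ f (g s) (deriv (deriv g) s)) = fun s =>
      fderiv ℝ (fderiv ℝ (fderiv ℝ f)) (g s) (deriv g s) (deriv g s) (deriv g s)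
        + (3 : ℝ) • fderiv ℝ (fderiv ℝ f) (g s) (deriv (deriv g) s) (deriv g s)
        + fderiv ℝ f (g s) (deriv (deriv (deriv g)) s) := by
    funext s
    have h := ((HasDerivAt.clm_apply_comp (d2 _) (hg s).hasDerivAt (hg' s).hasDerivAt).clm_apply
      (hg' s).hasDerivAt).add
        (HasDerivAt.clm_apply_comp (d1 _) (hg s).hasDerivAt (hg'' s).hasDerivAt)
    refine h.deriv.trans ?_
    simp only [add_apply, symm2 _ (deriv g s) (deriv (deriv g) s)]
    module
  have e4 := (((((HasDerivAt.clm_apply_comp (d3 _) (hg t).hasDerivAt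
      (hg' t).hasDerivAt).clm_apply (hg' t).hasDerivAt).clm_apply (hg' t).hasDerivAt).add
    (((HasDerivAt.clm_apply_comp (d2 _) (hg t).hasDerivAt (hg'' t).hasDerivAt).clm_apply
      (hg' t).hasDerivAt).const_smul (3 : ℝ))).add
    (HasDerivAt.clm_apply_comp (d1 _) (hg t).hasDerivAt (hg''' t).hasDerivAt)).deriv
  rw [iteratedDeriv_succ, iteratedDeriv_succ, iteratedDeriv_succ, iteratedDeriv_one, e1, e2, e3]
  refine e4.trans ?_
  simp only [iteratedFDeriv_succ_apply_right, iteratedFDeriv_zero_apply]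
  simp only [add_apply, symm2 _ (deriv g t) (deriv (deriv (deriv g)) t),
    symm3' _ (deriv g t) (deriv g t) (deriv (deriv g) t),
    symm3 _ (deriv g t) (deriv (deriv g) t)]
  simp [Fin.init]
  module
end
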